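/- Let s = 2k+1 with k ≥ 1, K ∈ 𝒦_s, and μ ∈ ℱ_s([0,1], λ). Then there exists a constant C > 0 such that for all h ∈ (0,1) and all t ∈ (h, 1-h) with |λ - t| < h, setting τ = (λ - t)/h, the remainder J_h(t) := -h^{-2} [ ∫_{-1}^{τ} K₂(x)(μ'(t+hx) - μ'(λ⁻)) dx + ∫_{τ}^{1} K₂(x)(μ'(t+hx) - μ'(λ⁺)) dx ] satisfies |J_h(t)| ≤ C h^{s-3}. -/

import Mathlib

open MeasureTheory ProbabilityTheory Filter Set Topology

noncomputable section

/-- Normalising constant `a_k` of the kink-detection kernel. -/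
def kinkA (k : ℕ) : ℝ :=
  (Nat.factorial (4*k+5) : ℝ) /
    (2^(4*k+5) * (Nat.factorial (2*k) : ℝ) * (Nat.factorial (2*k+2) : ℝ))

/-- Polynomial coefficients `b_{j,k}` of the kink-detection kernel. -/
def kinkB (j k : ℕ) : ℝ :=
  ((-1 : ℝ)^(k+j+1) * (Nat.factorial (2*j) : ℝ)) /
    ((Nat.factorial j : ℝ) * (Nat.factorial (2*k+2-j) : ℝ) *
      (Nat.factorial (2*j+2-2*k) : ℝ))

/-- The polynomial part of the kernel `K ∈ 𝒦_{2k+1}`. -/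
def kinkPoly (k : ℕ) : ℝ → ℝ := fun x =>
  kinkA k * ∑ j ∈ Finset.Icc (k-1) (2*k+2), kinkB j k * x ^ (2*j+2-2*k)

/-- `Kd k i` is the `i`-th derivative of the polynomial part of the kernel. -/
def Kd (k i : ℕ) : ℝ → ℝ := iteratedDeriv i (kinkPoly k)

/-- `Kde k i` is the `i`-th derivative of the polynomial part of the kernel,
extended by `0` outside `[-1,1]`. -/
def Kde (k i : ℕ) : ℝ → ℝ := fun x => if x ∈ Set.Icc (-1:ℝ) 1 then Kd k i x else 0

/-- The smoothed third derivative `κ_h(t, μ) = h⁻⁴ ∫₀¹ K₃((x-t)/h) μ(x) dx`. -/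
def kappah (k : ℕ) (h t : ℝ) (μ : ℝ → ℝ) : ℝ :=
  (h^4)⁻¹ * ∫ x in (0:ℝ)..1, Kde k 3 ((x - t)/h) * μ x

/-- The class `ℱ_s(λ)`: a kink of size `a_μ ≠ 0` in the first derivative at `λ`,
with `s`-smooth one-sided extensions whose derivatives of orders `2,…,s-1` match at `λ`. -/
def MemF (s : ℕ) (lam : ℝ) (μ : ℝ → ℝ) : Prop :=
  ∃ gm gp : ℝ → ℝ, ContDiff ℝ (s : ℕ∞) gm ∧ ContDiff ℝ (s : ℕ∞) gp ∧
    (∀ x ≤ lam, μ x = gm x) ∧ (∀ x, lam ≤ x → μ x = gp x) ∧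
    deriv gp lam - deriv gm lam ≠ 0 ∧
    ∀ i, 2 ≤ i → i ≤ s - 1 → iteratedDeriv i gp lam = iteratedDeriv i gm lam

/-- The no-kink class `𝒢_s`. -/
def MemG (s : ℕ) (μ : ℝ → ℝ) : Prop := ContDiff ℝ (s : ℕ∞) μ

/-- A slowly varying function. -/
def SlowlyVarying (L : ℝ → ℝ) : Prop :=
  (∀ x, 0 < x → 0 < L x) ∧
    ∀ c : ℝ, 0 < c → Tendsto (fun x : ℝ => L (c * x) / L x) atTop (𝓝 1)

/-- Coefficients of the causal LRD linear process. -/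
def lrdCoef (α : ℝ) (L : ℝ → ℝ) : ℕ → ℝ := fun i =>
  if i = 0 then 1 else (i : ℝ) ^ (-((1 + α) / 2)) * L i

/-- The filtration `ℱ_i = σ(…, η_{i-1}, η_i)` generated by the innovations. -/
def lrdFilt {Ω : Type*} [MeasurableSpace Ω] (η : ℤ → Ω → ℝ) (i : ℤ) : MeasurableSpace Ω :=
  ⨆ j : ℤ, ⨆ _ : j ≤ i, MeasurableSpace.comap (η j) (inferInstance : MeasurableSpace ℝ)


/-- Repeated integration by parts: the `n`-th derivative of a polynomial vanishing to order `n` at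
both endpoints is orthogonal to every polynomial of degree less than `n`. -/
theorem integral_iterate_derivative_mul_eq_zero {a b : ℝ} (R : Polynomial ℝ) (n : ℕ)
    (hR : ∀ i < n, (Polynomial.derivative^[i] R).eval a = 0 ∧
      (Polynomial.derivative^[i] R).eval b = 0)
    (p : Polynomial ℝ) (hp : p.degree < n) :
    ∫ x in a..b, (Polynomial.derivative^[n] R).eval x * p.eval x = 0 := by
  induction n generalizing p with
  | zero =>
    obtain rfl : p = 0 := by simpa using hp
    simp
  | succ n ih =>
    have hp' : (Polynomial.derivative p).degree < n := by
      rw [Polynomial.degree_lt_iff_coeff_zero] at hp ⊢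
      intro m hm
      rw [Polynomial.coeff_derivative, hp (m + 1) (by omega), zero_mul]
    have hparts := intervalIntegral.integral_deriv_mul_eq_sub (a := a) (b := b)
      (fun x _ => (Polynomial.derivative^[n] R).hasDerivAt x) (fun x _ => p.hasDerivAt x)
      ((Polynomial.continuous _).intervalIntegrable _ _)
      ((Polynomial.continuous _).intervalIntegrable _ _)
    rw [intervalIntegral.integral_add
        (Continuous.intervalIntegrable (by fun_prop) _ _)
        (Continuous.intervalIntegrable (by fun_prop) _ _),
      ih (fun i hi => hR i (by omega)) _ hp', (hR n n.lt_succ_self).1,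
      (hR n n.lt_succ_self).2] at hparts
    rw [Function.iterate_succ_apply']
    simpa using hparts

theorem iteratedDeriv_polynomial_eval (p : Polynomial ℝ) (n : ℕ) :
    iteratedDeriv n (fun x => p.eval x) =
      fun x => (Polynomial.derivative^[n] p).eval x := by
  induction n generalizing p with
  | zero => simp
  | succ n ih =>
    have hd : deriv (fun x => p.eval x) = fun x => p.derivative.eval x :=
      funext fun x => p.deriv
    rw [iteratedDeriv_succ', hd, ih, Function.iterate_succ_apply]

/-- A Rodrigues-type formula for the kernel polynomial. -/
theorem kinkPoly_eq_rodrigues (k : ℕ) (hk : 1 ≤ k) :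
    ∃ c : ℝ, kinkPoly k = fun x =>
      (Polynomial.derivative^[2 * k - 2]
        (Polynomial.C c * (1 - Polynomial.X ^ 2) ^ (2 * k + 2))).eval x := by
  obtain ⟨m, rfl⟩ : ∃ m, k = m + 1 := ⟨k - 1, by omega⟩
  refine ⟨kinkA (m + 1) * (-1) ^ m / (Nat.factorial (2 * m + 4)), funext fun x => ?_⟩
  have hexp : ((1 : Polynomial ℝ) - Polynomial.X ^ 2) ^ (2 * m + 4) =
      ∑ j ∈ Finset.range (2 * m + 5),
        Polynomial.C ((-1) ^ j * ((2 * m + 4).choose j : ℝ)) * Polynomial.X ^ (2 * j) := by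
    rw [sub_eq_neg_add, add_pow]
    refine Finset.sum_congr rfl fun j _ => ?_
    rw [neg_pow, ← pow_mul]
    simp only [one_pow, mul_one, map_mul, map_pow, map_neg, map_one, Polynomial.C_eq_natCast]
    ring
  rw [show 2 * (m + 1) - 2 = 2 * m by omega, show 2 * (m + 1) + 2 = 2 * m + 4 by ring,
    Polynomial.iterate_derivative_C_mul, hexp, Polynomial.iterate_derivative_sum]
  simp only [Polynomial.iterate_derivative_C_mul, Polynomial.iterate_derivative_X_pow_eq_C_mul,
    Polynomial.eval_mul, Polynomial.eval_finsetSum, Polynomial.eval_C, Polynomial.eval_pow,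
    Polynomial.eval_X]
  have hsub : Finset.Icc m (2 * m + 4) ⊆ Finset.range (2 * m + 5) := by
    intro j hj
    simp only [Finset.mem_Icc, Finset.mem_range] at *
    omega
  refine Eq.trans ?_ (congrArg (HMul.hMul _) (Finset.sum_subset hsub ?_))
  · simp only [kinkPoly]
    rw [Finset.mul_sum, Finset.mul_sum,
      show m + 1 - 1 = m by omega, show 2 * (m + 1) + 2 = 2 * m + 4 by ring]
    refine Finset.sum_congr rfl fun j hj => ?_
    rw [Finset.mem_Icc] at hj
    rw [show 2 * j + 2 - 2 * (m + 1) = 2 * j - 2 * m by omega, kinkB,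
      show 2 * (m + 1) + 2 - j = 2 * m + 4 - j by omega, show 2 * j + 2 - 2 * (m + 1) = 2 * j - 2 * m by omega,
      Nat.cast_choose ℝ hj.2,
      ← Nat.factorial_mul_descFactorial (show 2 * m ≤ 2 * j by omega),
      show m + 1 + j + 1 = m + j + 2 by ring, pow_add, pow_add]
    push_cast
    field_simp
  · intro j _ hj
    have : 2 * j < 2 * m := by
      simp only [Finset.mem_Icc, Finset.mem_range] at *
      omega
    simp [Nat.descFactorial_of_lt this]

/-- The second derivative of the kernel polynomial is continuous and orthogonal to all polynomials
of degree less than `2k`. -/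
theorem Kd_two_orthogonal (k : ℕ) (hk : 1 ≤ k) :
    Continuous (Kd k 2) ∧ ∀ p : Polynomial ℝ, p.degree < (2 * k : ℕ) →
      ∫ x in (-1 : ℝ)..1, Kd k 2 x * p.eval x = 0 := by
  obtain ⟨c, hc⟩ := kinkPoly_eq_rodrigues k hk
  set R := Polynomial.C c * (1 - Polynomial.X ^ 2) ^ (2 * k + 2) with hR
  have hK : Kd k 2 = fun x => (Polynomial.derivative^[2 * k] R).eval x := by
    rw [Kd, hc, iteratedDeriv_polynomial_eval, ← Function.iterate_add_apply,
      show 2 + (2 * k - 2) = 2 * k by omega]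
  refine ⟨hK ▸ Polynomial.continuous _, fun p hp => ?_⟩
  rw [hK]
  refine integral_iterate_derivative_mul_eq_zero R (2 * k) (fun i hi => ?_) p hp
  have hdvd : (1 - Polynomial.X ^ 2 : Polynomial ℝ) ∣ Polynomial.derivative^[i] R :=
    (dvd_pow_self _ (by omega)).trans
      (Polynomial.pow_sub_dvd_iterate_derivative_of_pow_dvd (n := 2 * k + 2) i
        (Dvd.intro_left _ rfl))
  obtain ⟨q, hq⟩ := hdvd
  rw [hq]
  simp

/-- A two-sided Taylor bound, uniform on `[0,1]`, for an expansion point in `[0,1]`. -/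
theorem exists_two_sided_taylor_bound {f : ℝ → ℝ} {a : ℝ} (ha : a ∈ Icc (0 : ℝ) 1) (n : ℕ)
    (hf : ContDiff ℝ (n + 1 : ℕ) f) :
    ∃ M, 0 ≤ M ∧ ∀ x ∈ Icc (0 : ℝ) 1,
      |f x - ∑ i ∈ Finset.range (n + 1), iteratedDeriv i f a / (Nat.factorial i) * (x - a) ^ i|
        ≤ M * |x - a| ^ (n + 1) := by
  obtain ⟨M, hM⟩ := isCompact_Icc.exists_bound_of_continuousOn (s := Icc (0 : ℝ) 1)
    (hf.continuous_iteratedDeriv (n + 1) le_rfl).continuousOn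
  have hM0 : 0 ≤ M := (norm_nonneg _).trans (hM a ha)
  refine ⟨M, hM0, fun x hx => ?_⟩
  rcases eq_or_ne a x with rfl | hax
  · simp [Finset.sum_range_succ']
  obtain ⟨y, hy, hxy⟩ := taylor_mean_remainder_lagrange_iteratedDeriv (n := n) hax
    (by exact_mod_cast hf.contDiffOn)
  have hsum : taylorWithinEval f n (uIcc a x) a x =
      ∑ i ∈ Finset.range (n + 1), iteratedDeriv i f a / (Nat.factorial i) * (x - a) ^ i := by
    rw [taylor_within_apply]
    refine Finset.sum_congr rfl fun i hi => ?_
    rw [iteratedDerivWithin_eq_iteratedDeriv (uniqueDiffOn_uIcc hax) _ left_mem_uIcc,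
      smul_eq_mul]
    · ring
    · exact hf.contDiffAt.of_le (by exact_mod_cast (Finset.mem_range.1 hi).le)
  have hy' : y ∈ Icc (0 : ℝ) 1 :=
    (convex_Icc (0 : ℝ) 1).ordConnected.uIcc_subset ha hx (uIoo_subset_uIcc_self hy)
  rw [← hsum, hxy, abs_div, abs_mul, abs_pow, Nat.abs_cast]
  have hfact : (1 : ℝ) ≤ (Nat.factorial (n + 1) : ℝ) := by
    exact_mod_cast Nat.factorial_pos (n + 1)
  refine (div_le_self (by positivity) hfact).trans ?_
  gcongr
  exact hM y hy'

/-- the Taylor remainder term `J_h(t)` is of order `h^{s-3}`. -/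
theorem remainder_Jh_bound (k : ℕ) (hk : 1 ≤ k) (lam : ℝ)
    (hlam : lam ∈ Set.Icc (0:ℝ) 1) (μ μ' gm gp : ℝ → ℝ)
    (hgm : ContDiff ℝ ((2*k+1 : ℕ) : ℕ∞) gm) (hgp : ContDiff ℝ ((2*k+1 : ℕ) : ℕ∞) gp)
    (hm : ∀ x ≤ lam, μ x = gm x) (hp : ∀ x, lam ≤ x → μ x = gp x)
    (hjump : deriv gp lam - deriv gm lam ≠ 0)
    (hhigh : ∀ i, 2 ≤ i → i ≤ 2*k → iteratedDeriv i gp lam = iteratedDeriv i gm lam)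
    (hmu' : ∀ x, x ≠ lam → HasDerivAt μ (μ' x) x) :
    ∃ C > 0, ∀ h ∈ Set.Ioo (0:ℝ) 1, ∀ t ∈ Set.Ioo h (1-h), |lam - t| < h →
      |-(h^2)⁻¹ *
          ((∫ x in (-1:ℝ)..((lam - t)/h), Kd k 2 x * (μ' (t + h*x) - deriv gm lam)) +
            ∫ x in ((lam - t)/h)..(1:ℝ), Kd k 2 x * (μ' (t + h*x) - deriv gp lam))| ≤
        C * h^(2*k-2) := by
  obtain ⟨hKc, hKorth⟩ := Kd_two_orthogonal k hk
  obtain ⟨B, hB⟩ := isCompact_Icc.exists_bound_of_continuousOn (s := Icc (-1 : ℝ) 1)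
    hKc.continuousOn
  have hB0 : 0 ≤ B := (norm_nonneg _).trans (hB 0 (by norm_num))
  obtain ⟨n, hn⟩ : ∃ n, 2 * k = n + 1 := ⟨2 * k - 1, by omega⟩
  set P : Polynomial ℝ := ∑ i ∈ Finset.range n,
    Polynomial.C (iteratedDeriv (i + 2) gm lam / (Nat.factorial (i + 1))) *
      (Polynomial.X - Polynomial.C lam) ^ (i + 1) with hP
  have hgm' : ContDiff ℝ (n + 1 : ℕ) (deriv gm) := by
    have := hgm
    rw [hn] at this
    exact (contDiff_succ_iff_deriv.1 (by exact_mod_cast this)).2.2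
  have hgp' : ContDiff ℝ (n + 1 : ℕ) (deriv gp) := by
    have := hgp
    rw [hn] at this
    exact (contDiff_succ_iff_deriv.1 (by exact_mod_cast this)).2.2
  have htaylor : ∀ g : ℝ → ℝ, ContDiff ℝ (n + 1 : ℕ) (deriv g) →
      (∀ i < n, iteratedDeriv (i + 2) g lam = iteratedDeriv (i + 2) gm lam) →
      ∃ M, 0 ≤ M ∧ ∀ x ∈ Icc (0 : ℝ) 1,
        |deriv g x - deriv g lam - P.eval x| ≤ M * |x - lam| ^ (n + 1) := by
    intro g hg hgi
    obtain ⟨M, hM0, hM⟩ := exists_two_sided_taylor_bound hlam n hg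
    refine ⟨M, hM0, fun x hx => ?_⟩
    convert hM x hx using 2
    rw [Finset.sum_range_succ', hP, Polynomial.eval_finsetSum]
    have hterm : ∀ i ∈ Finset.range n,
        iteratedDeriv (i + 1) (deriv g) lam / (Nat.factorial (i + 1)) * (x - lam) ^ (i + 1) =
        (Polynomial.C (iteratedDeriv (i + 2) gm lam / (Nat.factorial (i + 1))) *
          (Polynomial.X - Polynomial.C lam) ^ (i + 1)).eval x := fun i hi => by
      rw [← iteratedDeriv_succ', hgi i (Finset.mem_range.1 hi)]
      simp
    rw [Finset.sum_congr rfl hterm]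
    simp only [iteratedDeriv_zero, Nat.factorial_zero, Nat.cast_one, div_one, pow_zero, mul_one]
    ring
  obtain ⟨Mm, hMm0, hMm⟩ := htaylor gm hgm' fun _ _ => rfl
  obtain ⟨Mp, hMp0, hMp⟩ := htaylor gp hgp' fun i hi => hhigh _ (by omega) (by omega)
  have hdm : ∀ y < lam, μ' y = deriv gm y := fun y hy => by
    have heq : μ =ᶠ[𝓝 y] gm := by
      filter_upwards [Iio_mem_nhds hy] with z hz using hm z (le_of_lt hz)
    rw [← heq.deriv_eq, (hmu' y hy.ne).deriv]
  have hdp : ∀ y, lam < y → μ' y = deriv gp y := fun y hy => by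
    have heq : μ =ᶠ[𝓝 y] gp := by
      filter_upwards [Ioi_mem_nhds hy] with z hz using hp z (le_of_lt hz)
    rw [← heq.deriv_eq, (hmu' y hy.ne').deriv]
  refine ⟨2 * (B * ((Mm + Mp) * 2 ^ (n + 1))) + 1, by positivity, ?_⟩
  rintro h ⟨hh0, hh1⟩ t ⟨ht0, ht1⟩ hlt
  set τ := (lam - t) / h with hτ
  have hτh : h * τ = lam - t := by rw [hτ]; field_simp
  obtain ⟨hlt1, hlt2⟩ := abs_lt.1 hlt
  have hτ1 : -1 < τ := by rw [hτ, lt_div_iff₀ hh0]; linarith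
  have hτ2 : τ < 1 := by rw [hτ, div_lt_iff₀ hh0]; linarith
  have hcm : Continuous (deriv gm) := hgm'.continuous
  have hcp : Continuous (deriv gp) := hgp'.continuous
  have hcP : Continuous fun x : ℝ => P.eval x := P.continuous
  have hiP : ∀ a b : ℝ, IntervalIntegrable (fun x => Kd k 2 x * P.eval (t + h * x))
      volume a b := fun a b => Continuous.intervalIntegrable (by fun_prop) a b
  have hleft : (∫ x in (-1 : ℝ)..τ, Kd k 2 x * (μ' (t + h * x) - deriv gm lam)) =
      (∫ x in (-1 : ℝ)..τ, Kd k 2 x * P.eval (t + h * x)) +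
      ∫ x in (-1 : ℝ)..τ,
        Kd k 2 x * (deriv gm (t + h * x) - deriv gm lam - P.eval (t + h * x)) := by
    rw [← intervalIntegral.integral_add (hiP _ _)
      (Continuous.intervalIntegrable (by fun_prop) _ _)]
    refine intervalIntegral.integral_congr_Ioo_of_le hτ1.le fun x hx => ?_
    have hlt : t + h * x < lam := by linarith [mul_lt_mul_of_pos_left hx.2 hh0]
    simp only [hdm _ hlt]
    ring
  have hright : (∫ x in τ..(1 : ℝ), Kd k 2 x * (μ' (t + h * x) - deriv gp lam)) =
      (∫ x in τ..(1 : ℝ), Kd k 2 x * P.eval (t + h * x)) +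
      ∫ x in τ..(1 : ℝ),
        Kd k 2 x * (deriv gp (t + h * x) - deriv gp lam - P.eval (t + h * x)) := by
    rw [← intervalIntegral.integral_add (hiP _ _)
      (Continuous.intervalIntegrable (by fun_prop) _ _)]
    refine intervalIntegral.integral_congr_Ioo_of_le hτ2.le fun x hx => ?_
    have hlt : lam < t + h * x := by linarith [mul_lt_mul_of_pos_left hx.1 hh0]
    simp only [hdp _ hlt]
    ring
  have hPdeg : P.natDegree ≤ n := by
    refine Polynomial.natDegree_sum_le_of_forall_le _ _ fun i hi => ?_
    refine (Polynomial.natDegree_C_mul_le _ _).trans ?_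
    rw [Polynomial.natDegree_pow, Polynomial.natDegree_X_sub_C]
    have := Finset.mem_range.1 hi
    omega
  have horth : ∫ x in (-1 : ℝ)..1, Kd k 2 x * P.eval (t + h * x) = 0 := by
    have hdeg : (P.comp (Polynomial.C h * Polynomial.X + Polynomial.C t)).degree <
        (2 * k : ℕ) := by
      refine Polynomial.degree_le_natDegree.trans_lt ?_
      have h1 := Polynomial.natDegree_comp_le (p := P)
        (q := Polynomial.C h * Polynomial.X + Polynomial.C t)
      have h2 := Nat.mul_le_mul hPdeg (Polynomial.natDegree_linear_le (a := h) (b := t))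
      exact_mod_cast (by omega)
    have := hKorth _ hdeg
    simpa [add_comm t] using this
  have hrem : ∀ (M : ℝ) (r : ℝ → ℝ), 0 ≤ M →
      (∀ x ∈ Icc (0 : ℝ) 1, |r x| ≤ M * |x - lam| ^ (n + 1)) →
      ∀ a b : ℝ, -1 ≤ a → a ≤ b → b ≤ 1 →
        |∫ x in a..b, Kd k 2 x * r (t + h * x)| ≤
          2 * (B * (M * 2 ^ (n + 1))) * h ^ (n + 1) := by
    intro M r hM0 hr a b ha hab hb
    have hbound : ∀ x ∈ uIoc a b, ‖Kd k 2 x * r (t + h * x)‖ ≤ B * (M * (2 * h) ^ (n + 1)) := by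
      intro x hx
      rw [uIoc_of_le hab] at hx
      have hx1 : -1 ≤ x := ha.trans hx.1.le
      have hx2 : x ≤ 1 := hx.2.trans hb
      have hxh1 : -h ≤ h * x := by nlinarith
      have hxh2 : h * x ≤ h := by nlinarith
      rw [norm_mul]
      refine mul_le_mul (hB x ⟨hx1, hx2⟩) ?_ (norm_nonneg _) hB0
      refine (hr _ ⟨by linarith, by linarith⟩).trans ?_
      gcongr
      rw [abs_le]
      constructor <;> linarith
    refine (intervalIntegral.norm_integral_le_of_norm_le_const hbound).trans ?_
    rw [abs_of_nonneg (sub_nonneg.2 hab), mul_pow]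
    have hnn : 0 ≤ B * (M * (2 ^ (n + 1) * h ^ (n + 1))) := by positivity
    nlinarith [mul_le_mul_of_nonneg_left (show b - a ≤ 2 by linarith) hnn]
  have hadj := intervalIntegral.integral_add_adjacent_intervals (hiP (-1) τ) (hiP τ 1)
  have h1 := hrem Mm _ hMm0 hMm (-1) τ le_rfl hτ1.le hτ2.le
  have h2 := hrem Mp _ hMp0 hMp τ 1 hτ1.le hτ2.le le_rfl
  rw [hleft, hright, add_add_add_comm, hadj, horth, zero_add, abs_mul, abs_neg,
    abs_of_pos (by positivity), inv_mul_le_iff₀ (by positivity)]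
  refine (abs_add_le _ _).trans ((add_le_add h1 h2).trans ?_)
  have hpow : h ^ (n + 1) = h ^ 2 * h ^ (2 * k - 2) := by
    rw [← pow_add]
    congr 1
    omega
  have hnn : 0 ≤ h ^ 2 * h ^ (2 * k - 2) := by positivity
  rw [hpow]
  linarith

end
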